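/- The function R(t,s) = H · ∫₀^{min(t,s)} (min(t,s) - a)^{2H-1} · ((max(t,s)+a)^{-1/2} + (max(t,s)-a)^{-1/2}) da, defined for s, t ∈ (0, T], is symmetric and positive semidefinite; i.e., for any n, any t₁,...,tₙ ∈ (0,T] and any real λ₁,...,λₙ, ∑_{i,j} λᵢλⱼ R(tᵢ, tⱼ) ≥ 0. -/

import Mathlib

open MeasureTheory

noncomputable def R (H t s : ℝ) : ℝ :=
  H * ∫ a in (0:ℝ)..(min t s),
    (min t s - a) ^ (2*H - 1) * ((max t s + a) ^ (-(1:ℝ)/2) + (max t s - a) ^ (-(1:ℝ)/2))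

lemma min_psd {n : ℕ} (c x : Fin n → ℝ) (hx : ∀ i, 0 ≤ x i) :
    0 ≤ ∑ i, ∑ j, c i * c j * min (x i) (x j) := by
  have hm : ∀ i j, min (x i) (x j) =
      ∫ u, (Set.Ioc 0 (x i)).indicator 1 u * (Set.Ioc 0 (x j)).indicator (1 : ℝ → ℝ) u := by
    intro i j
    have : (fun u => (Set.Ioc 0 (x i)).indicator 1 u * (Set.Ioc 0 (x j)).indicator (1 : ℝ → ℝ) u)
        = (Set.Ioc 0 (min (x i) (x j))).indicator 1 := by
      rw [show Set.Ioc 0 (min (x i) (x j)) = Set.Ioc 0 (x i) ∩ Set.Ioc 0 (x j) by simp [Set.Ioc_inter_Ioc], Set.inter_indicator_one]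
      rfl
    rw [this, integral_indicator_one measurableSet_Ioc]
    simp [hx]
  have hi : ∀ i j, Integrable (fun u =>
      (Set.Ioc 0 (x i)).indicator 1 u * (Set.Ioc 0 (x j)).indicator (1 : ℝ → ℝ) u) := by
    intro i j
    have : (fun u => (Set.Ioc 0 (x i)).indicator 1 u * (Set.Ioc 0 (x j)).indicator (1 : ℝ → ℝ) u)
        = (Set.Ioc 0 (min (x i) (x j))).indicator 1 := by
      rw [show Set.Ioc 0 (min (x i) (x j)) = Set.Ioc 0 (x i) ∩ Set.Ioc 0 (x j) by simp [Set.Ioc_inter_Ioc], Set.inter_indicator_one]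
      rfl
    rw [this, integrable_indicator_iff measurableSet_Ioc]
    exact integrableOn_const (by simp)
  simp_rw [hm, ← integral_const_mul]
  simp_rw [← integral_finsetSum Finset.univ (fun j _ => (hi _ j).const_mul _)]
  rw [← integral_finsetSum Finset.univ
    (fun i _ => integrable_finsetSum _ fun j _ => (hi i j).const_mul _)]
  refine integral_nonneg fun u => ?_
  have : ∑ i, ∑ j, c i * c j * ((Set.Ioc 0 (x i)).indicator 1 u *
      (Set.Ioc 0 (x j)).indicator (1 : ℝ → ℝ) u)
      = (∑ i, c i * (Set.Ioc 0 (x i)).indicator (1 : ℝ → ℝ) u) ^ 2 := by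
    rw [sq, Finset.sum_mul_sum]
    exact Finset.sum_congr rfl fun i _ => Finset.sum_congr rfl fun j _ => by ring
  simpa [this] using sq_nonneg _

/-- The pointwise kernel. -/
lemma kernel_psd {n : ℕ} (lam t : Fin n → ℝ) (a p : ℝ) (hp : 0 ≤ p) (f : ℝ → ℝ)
    (hf : ∀ t, a < t → 0 < f t) (hanti : ∀ s t, a < s → s ≤ t → f t ≤ f s) :
    0 ≤ ∑ i, ∑ j, lam i * lam j *
      (if a < min (t i) (t j) then (min (t i) (t j) - a) ^ p * f (max (t i) (t j)) else 0) := by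
  have hx : ∀ i, 0 ≤ (if a < t i then (t i - a) ^ p / f (t i) else 0) := by
    intro i
    split_ifs with h
    · exact div_nonneg (Real.rpow_nonneg (by linarith) _) (hf _ h).le
    · exact le_rfl
  have key := min_psd (fun i => lam i * if a < t i then f (t i) else 0) _ hx
  have hmon : ∀ s t, a < s → s ≤ t → (s - a) ^ p / f s ≤ (t - a) ^ p / f t := by
    intro s t hs hst
    exact div_le_div₀ (Real.rpow_nonneg (by linarith) _)
      (Real.rpow_le_rpow (by linarith) (by linarith) hp) (hf _ (hs.trans_le hst))
      (hanti _ _ hs hst)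
  refine key.trans_eq (Finset.sum_congr rfl fun i _ => Finset.sum_congr rfl fun j _ => ?_)
  by_cases h1 : a < t i
  · by_cases h2 : a < t j
    · have f1 := (hf _ h1).ne'
      have f2 := (hf _ h2).ne'
      simp only [h1, h2, lt_min_iff, and_self, if_true]
      rcases le_total (t i) (t j) with h | h
      · rw [min_eq_left (hmon _ _ h1 h), min_eq_left h, max_eq_right h]
        field_simp
      · rw [min_eq_right (hmon _ _ h2 h), min_eq_right h, max_eq_left h]
        field_simp
    · simp [h2]
  · simp [h1]

/-- Integrand extended by zero. -/
noncomputable def FF (H t s a : ℝ) : ℝ :=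
  (if a < min t s then (min t s - a) ^ (2*H - 1) * (max t s + a) ^ (-(1:ℝ)/2) else 0) +
  (if a < min t s then (min t s - a) ^ (2*H - 1) * (max t s - a) ^ (-(1:ℝ)/2) else 0)

lemma FF_eq (H t s : ℝ) : FF H t s = (Set.Iio (min t s)).indicator (fun a =>
    (min t s - a) ^ (2*H - 1) * ((max t s + a) ^ (-(1:ℝ)/2) + (max t s - a) ^ (-(1:ℝ)/2))) := by
  funext a
  by_cases h : a < min t s
  · simp only [FF, h, if_true, Set.indicator, Set.mem_Iio]; ring
  · simp only [FF, h, if_false, Set.indicator, Set.mem_Iio]; ring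

lemma int_base (H t s : ℝ) (hH1 : 1/2 < H) (ht : 0 < t) (hs : 0 < s) :
    IntegrableOn (fun a =>
    (min t s - a) ^ (2*H - 1) * ((max t s + a) ^ (-(1:ℝ)/2) + (max t s - a) ^ (-(1:ℝ)/2)))
      (Set.Ioo 0 (min t s)) := by
  have hm : 0 < min t s := lt_min ht hs
  have hmM : min t s ≤ max t s := min_le_max
  generalize min t s = m at *
  generalize max t s = M at *
  have h0 : IntervalIntegrable (fun x : ℝ => x ^ (2*H - 1 + (-(1:ℝ)/2))) volume 0 m :=
    intervalIntegral.intervalIntegrable_rpow' (by linarith)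
  have h1 := ((h0.comp_sub_left m).symm).const_mul 2
  simp only [sub_zero, sub_self] at h1
  rw [intervalIntegrable_iff_integrableOn_Ioo_of_le hm.le] at h1
  refine Integrable.mono' h1 (by fun_prop) ?_
  refine (ae_restrict_iff' measurableSet_Ioo).2 (Filter.Eventually.of_forall fun a ha => ?_)
  obtain ⟨ha, ham⟩ := ha
  have hd : 0 < m - a := by linarith
  have e1 : (M + a) ^ (-(1:ℝ)/2) ≤ (m - a) ^ (-(1:ℝ)/2) :=
    Real.rpow_le_rpow_of_nonpos hd (by linarith) (by norm_num)
  have e2 : (M - a) ^ (-(1:ℝ)/2) ≤ (m - a) ^ (-(1:ℝ)/2) :=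
    Real.rpow_le_rpow_of_nonpos hd (by linarith) (by norm_num)
  have p1 : 0 ≤ (M + a) ^ (-(1:ℝ)/2) := Real.rpow_nonneg (by linarith) _
  have p2 : 0 ≤ (M - a) ^ (-(1:ℝ)/2) := Real.rpow_nonneg (by linarith) _
  have p3 : 0 ≤ (m - a) ^ (2*H-1) := Real.rpow_nonneg hd.le _
  rw [Real.norm_of_nonneg (by positivity), Real.rpow_add hd]
  nlinarith

lemma FF_int (H t s : ℝ) (hH1 : 1/2 < H) (ht : 0 < t) (hs : 0 < s) :
    IntegrableOn (FF H t s) (Set.Ioi 0) := by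
  rw [FF_eq, integrableOn_indicator_iff measurableSet_Iio, Set.inter_comm, Set.Ioi_inter_Iio]
  exact int_base H t s hH1 ht hs

lemma R_eq (H t s : ℝ) (ht : 0 < t) (hs : 0 < s) :
    R H t s = H * ∫ a in Set.Ioi 0, FF H t s a := by
  rw [FF_eq, setIntegral_indicator measurableSet_Iio, Set.Ioi_inter_Iio, R,
    intervalIntegral.integral_of_le (lt_min ht hs).le, integral_Ioc_eq_integral_Ioo]

theorem stmt3 (H T : ℝ) (hH1 : 1/2 < H) (hH2 : H < 1) (hT : 0 < T) :
    (∀ t ∈ Set.Ioc 0 T, ∀ s ∈ Set.Ioc 0 T, R H t s = R H s t) ∧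
    (∀ (n : ℕ) (t : Fin n → ℝ), (∀ i, t i ∈ Set.Ioc 0 T) → ∀ lam : Fin n → ℝ,
      0 ≤ ∑ i, ∑ j, lam i * lam j * R H (t i) (t j)) := by
  refine ⟨fun t _ s _ => by simp only [R, min_comm t s, max_comm t s], ?_⟩
  intro n t ht lam
  have hi : ∀ i j, IntegrableOn (FF H (t i) (t j)) (Set.Ioi 0) :=
    fun i j => FF_int H _ _ hH1 (ht i).1 (ht j).1
  have hR : ∑ i, ∑ j, lam i * lam j * R H (t i) (t j) =
      H * ∫ a in Set.Ioi 0, ∑ i, ∑ j, lam i * lam j * FF H (t i) (t j) a := by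
    rw [integral_finsetSum Finset.univ
      (fun i _ => integrable_finsetSum _ fun j _ => (hi i j).const_mul _), Finset.mul_sum]
    refine Finset.sum_congr rfl fun i _ => ?_
    rw [integral_finsetSum Finset.univ (fun j _ => (hi i j).const_mul _), Finset.mul_sum]
    refine Finset.sum_congr rfl fun j _ => ?_
    rw [integral_const_mul, R_eq H _ _ (ht i).1 (ht j).1]
    ring
  rw [hR]
  refine mul_nonneg (by linarith) (setIntegral_nonneg measurableSet_Ioi fun a ha => ?_)
  have ha : 0 < a := ha
  have k1 := kernel_psd lam t a (2*H-1) (by linarith) (fun t => (t + a) ^ (-(1:ℝ)/2))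
    (fun t h => Real.rpow_pos_of_pos (by linarith) _)
    (fun s t h h' => Real.rpow_le_rpow_of_nonpos (by linarith) (by linarith) (by norm_num))
  have k2 := kernel_psd lam t a (2*H-1) (by linarith) (fun t => (t - a) ^ (-(1:ℝ)/2))
    (fun t h => Real.rpow_pos_of_pos (by linarith) _)
    (fun s t h h' => Real.rpow_le_rpow_of_nonpos (by linarith) (by linarith) (by norm_num))
  simp only [FF, mul_add, Finset.sum_add_distrib] at *
  exact add_nonneg k1 k2
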